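/- There exists a constant c > 0 such that for every n ≥ 1, every family of unit vectors n₁,…,n_n on the unit circle S¹ ⊆ ℝ², and every weights α₁,…,α_n ≥ 0 with Σᵢ αᵢ = 1, the function f(x) = Σᵢ αᵢ·|⟨nᵢ, x⟩| on S¹ satisfies (∫_{S¹} (f(x) − 2/π)² dσ(x))^{1/2} ≥ c·n^{−2}, where σ is the normalized (probability) arc-length measure on S¹. (Bourgain–Lindenstrauss–Milman L² lower bound for zonogon approximation of the disk.) -/

import Mathlib

open MeasureTheory Real
open scoped RealInnerProductSpace

/-- The rotation-invariant arc-length measure on the unit circle `S¹ ⊆ ℝ²`, normalized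
to be a probability measure. -/
noncomputable def circleProb :
    Measure (Metric.sphere (0 : EuclideanSpace ℝ (Fin 2)) 1) :=
  ((volume : Measure (EuclideanSpace ℝ (Fin 2))).toSphere Set.univ)⁻¹ •
    (volume : Measure (EuclideanSpace ℝ (Fin 2))).toSphere

namespace BLMAux

open scoped Pointwise ENNReal

abbrev Pl := EuclideanSpace ℝ (Fin 2)
abbrev Sp := Metric.sphere (0 : EuclideanSpace ℝ (Fin 2)) 1

lemma toSphere_univ : (volume : Measure Pl).toSphere Set.univ = ENNReal.ofReal (2 * π) := by
  rw [Measure.toSphere_apply_univ, EuclideanSpace.volume_ball_fin_two]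
  rw [ENNReal.ofReal_mul (by norm_num)]
  simp

instance : IsProbabilityMeasure circleProb := by
  constructor
  rw [circleProb, Measure.smul_apply, smul_eq_mul]
  refine ENNReal.inv_mul_cancel ?_ ?_
  · rw [toSphere_univ]
    simp [pi_pos]
  · exact measure_ne_top _ _

/-- The action of a linear isometry on the sphere. -/
noncomputable def act (R : Pl ≃ₗᵢ[ℝ] Pl) (x : Sp) : Sp :=
  ⟨R x, by simp⟩

lemma act_continuous (R : Pl ≃ₗᵢ[ℝ] Pl) : Continuous (act R) := by
  unfold act
  fun_prop

lemma act_mp (R : Pl ≃ₗᵢ[ℝ] Pl) : MeasurePreserving (act R) circleProb circleProb := by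
  refine ⟨(act_continuous R).measurable, ?_⟩
  ext s hs
  have hs' : MeasurableSet (act R ⁻¹' s) := (act_continuous R).measurable hs
  rw [Measure.map_apply (act_continuous R).measurable hs, circleProb, Measure.smul_apply,
    Measure.smul_apply, Measure.toSphere_apply' _ hs, Measure.toSphere_apply' _ hs']
  have key : (R ⁻¹' (Set.Ioo (0:ℝ) 1 • ((↑) '' s : Set Pl)))
      = Set.Ioo (0:ℝ) 1 • ((↑) '' (act R ⁻¹' s) : Set Pl) := by
    ext y
    simp only [Set.mem_preimage, Set.mem_smul, Set.mem_image]
    constructor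
    · rintro ⟨r, hr, _, ⟨x, hx, rfl⟩, h⟩
      refine ⟨r, hr, R.symm x, ⟨act R.symm x, ?_, rfl⟩, ?_⟩
      · have : act R (act R.symm x) = x := by
          ext1; simp [act]
        rw [this]; exact hx
      · rw [← map_smul, h]; simp
    · rintro ⟨r, hr, _, ⟨x, hx, rfl⟩, rfl⟩
      exact ⟨r, hr, R x, ⟨act R x, hx, rfl⟩, by simp⟩
  rw [← key]
  congr 2
  exact (R.measurePreserving).measure_preimage_equiv (f := R.toMeasurableEquiv) _

lemma integral_act (R : Pl ≃ₗᵢ[ℝ] Pl) (F : Sp → ℝ) (hF : Continuous F) :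
    ∫ x, F (act R x) ∂circleProb = ∫ x, F x ∂circleProb := by
  conv_rhs => rw [← (act_mp R).map_eq]
  rw [integral_map (act_continuous R).aemeasurable hF.aestronglyMeasurable]

lemma integrable_cont (F : Sp → ℝ) (hF : Continuous F) : Integrable F circleProb :=
  hF.integrable_of_hasCompactSupport (HasCompactSupport.of_compactSpace F)

lemma bad_measure (v : Pl) (hv : ‖v‖ = 1) (S : ℝ) (hS : 0 ≤ S) :
    circleProb.real {x : Sp | |⟪v, (x : Pl)⟫| ≤ S} ≤ 4 * S / π := by
  have hm : MeasurableSet {x : Sp | |⟪v, (x : Pl)⟫| ≤ S} :=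
    (isClosed_le (by fun_prop) continuous_const).measurableSet
  obtain ⟨b, hb⟩ := Orthonormal.exists_orthonormalBasis_extension_of_card_eq
    (𝕜 := ℝ) (E := Pl) (ι := Fin 2) (by simp) (v := fun _ => v) (s := {0}) (by
      constructor
      · intro i; simpa using hv
      · intro i j hij
        exact absurd (Subsingleton.elim i j) hij)
  have hb0 : b 0 = v := hb 0 rfl
  let box : Set (Fin 2 → ℝ) := Set.Icc ![-S, -1] ![S, 1]
  have hbox : volume box = ENNReal.ofReal (4 * S) := by
    rw [Real.volume_Icc_pi, Fin.prod_univ_two, ← ENNReal.ofReal_mul (by simp; linarith)]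
    congr 1
    simp
    ring
  have hmp := (PiLp.volume_preserving_ofLp (Fin 2)).comp b.measurePreserving_repr
  have hpre : volume ((WithLp.ofLp ∘ b.repr) ⁻¹' box) = ENNReal.ofReal (4 * S) := by
    rw [hmp.measure_preimage measurableSet_Icc.nullMeasurableSet, hbox]
  have hle : (volume : Measure Pl).toSphere {x : Sp | |⟪v, (x : Pl)⟫| ≤ S}
      ≤ ENNReal.ofReal (8 * S) := by
    rw [Measure.toSphere_apply' _ hm]
    have : ENNReal.ofReal (8 * S) = 2 * ENNReal.ofReal (4 * S) := by
      rw [show 8 * S = 2 * (4 * S) by ring, ENNReal.ofReal_mul (by norm_num)]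
      simp
    rw [this, ← hpre]
    simp only [finrank_euclideanSpace, Fintype.card_fin, Nat.cast_ofNat]
    gcongr
    rintro _ ⟨r, hr, _, ⟨x, hx, rfl⟩, rfl⟩
    have hx1 : ‖(x : Pl)‖ = 1 := by simp
    have h0 : |r * ⟪v, (x : Pl)⟫| ≤ S := by
      rw [abs_mul, abs_of_pos hr.1]
      have : |⟪v, (x : Pl)⟫| ≤ S := hx
      nlinarith [abs_nonneg ⟪v, (x : Pl)⟫, hr.2, hr.1]
    have h1 : |r * ⟪b 1, (x : Pl)⟫| ≤ 1 := by
      rw [abs_mul, abs_of_pos hr.1]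
      have : |⟪b 1, (x : Pl)⟫| ≤ 1 := by
        have := abs_real_inner_le_norm (b 1) (x : Pl)
        rw [hx1, b.norm_eq_one] at this
        linarith
      nlinarith [abs_nonneg ⟪b 1, (x : Pl)⟫, hr.2, hr.1]
    rw [abs_le] at h0 h1
    simp only [Set.mem_preimage, box, Set.mem_Icc, Pi.le_def, Fin.forall_fin_two]
    simp [OrthonormalBasis.repr_apply_apply, hb0]
    exact ⟨⟨h0.1, h1.1⟩, h0.2, h1.2⟩
  rw [Measure.real, circleProb, Measure.smul_apply, toSphere_univ, smul_eq_mul]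
  apply ENNReal.toReal_le_of_le_ofReal (by positivity)
  calc _ ≤ (ENNReal.ofReal (2 * π))⁻¹ * ENNReal.ofReal (8 * S) := by gcongr
    _ = ENNReal.ofReal (4 * S / π) := by
      rw [← ENNReal.ofReal_inv_of_pos (by positivity), ← ENNReal.ofReal_mul (by positivity)]
      congr 1
      field_simp
      ring

lemma abs_identity (c S p q : ℝ) (hc : 0 < c) (hS : 0 ≤ S) (hcs : c ^ 2 + S ^ 2 = 1)
    (hpq : p ^ 2 + q ^ 2 = 1) (hp : S < |p|) :
    |c * p + S * q| + |c * p - S * q| = 2 * c * |p| := by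
  have hq : |q| < c := by
    apply abs_lt_of_sq_lt_sq _ hc.le
    have := sq_abs p
    nlinarith
  have h1 : |S * q| ≤ c * |p| := by
    rw [abs_mul, abs_of_nonneg hS]
    nlinarith [abs_nonneg q]
  rw [abs_le] at h1
  rcases le_total 0 p with h | h
  · rw [abs_of_nonneg h] at *
    rw [abs_of_nonneg (by linarith), abs_of_nonneg (by linarith)]; ring
  · rw [abs_of_nonpos h] at *
    rw [abs_of_nonpos (by linarith), abs_of_nonpos (by linarith)]; ring

instance : Fact (Module.finrank ℝ Pl = 2) := ⟨by simp⟩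

/-- Standard orientation. -/
noncomputable def ori : Orientation ℝ Pl (Fin 2) :=
  (EuclideanSpace.basisFun (Fin 2) ℝ).toBasis.orientation

noncomputable def rot (s : ℝ) : Pl ≃ₗᵢ[ℝ] Pl := ori.rotation (s : Real.Angle)

lemma inner_rot (s : ℝ) (v x : Pl) :
    ⟪v, rot s x⟫ = cos s * ⟪v, x⟫ + sin s * ⟪v, ori.rightAngleRotation x⟫ := by
  simp [rot, Orientation.rotation_apply, inner_add_right, inner_smul_right]

lemma main_bound (n : ℕ) (hn : 1 ≤ n) (v : Fin n → Pl) (hv : ∀ i, ‖v i‖ = 1)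
    (α : Fin n → ℝ) :
    1 / (2304 * π ^ 2 * (n:ℝ) ^ 4) ≤
      ∫ x : Sp, ((∑ i, α i * |⟪v i, (x : Pl)⟫|) - 2 / π) ^ 2 ∂circleProb := by
  have hn0 : (1:ℝ) ≤ n := by exact_mod_cast hn
  have hpi := pi_pos
  set g : Sp → ℝ := fun x => (∑ i, α i * |⟪v i, (x : Pl)⟫|) - 2 / π with hg
  have hgc : Continuous g := by fun_prop
  set s : ℝ := π / (8 * n) with hs
  have hs0 : 0 < s := by positivity
  have hs1 : s < π / 2 := by
    rw [hs]; gcongr; linarith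
  have hc : 0 < cos s := cos_pos_of_mem_Ioo ⟨by linarith, hs1⟩
  have hS : 0 ≤ sin s := sin_nonneg_of_nonneg_of_le_pi hs0.le (by linarith)
  have hSle : sin s ≤ s := sin_le hs0.le
  have hcos : 1 / (32 * (n:ℝ) ^ 2) ≤ 1 - cos s := by
    have h := cos_le_one_sub_mul_cos_sq (x := s) (by rw [abs_of_pos hs0]; linarith)
    have : 2 / π ^ 2 * s ^ 2 = 1 / (32 * (n:ℝ) ^ 2) := by
      rw [hs]; field_simp; norm_num
    linarith
  set D : Sp → ℝ := fun x => g (act (rot s) x) + g (act (rot (-s)) x) - 2 * cos s * g x with hD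
  have hg1 : Continuous fun x => g (act (rot s) x) := hgc.comp (act_continuous _)
  have hg2 : Continuous fun x => g (act (rot (-s)) x) := hgc.comp (act_continuous _)
  have hDc : Continuous D := (hg1.add hg2).sub (continuous_const.mul hgc)
  have hup : ∫ x, D x ^ 2 ∂circleProb ≤ 18 * ∫ x, g x ^ 2 ∂circleProb := by
    have e1 := integral_act (rot s) (fun x => g x ^ 2) (by fun_prop)
    have e2 := integral_act (rot (-s)) (fun x => g x ^ 2) (by fun_prop)
    have i1 := integrable_cont (fun x => g (act (rot s) x) ^ 2) (hg1.pow 2)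
    have i2 := integrable_cont (fun x => g (act (rot (-s)) x) ^ 2) (hg2.pow 2)
    have i3 := integrable_cont (fun x => g x ^ 2) (by fun_prop)
    have i12 : Integrable (fun x => g (act (rot s) x) ^ 2 + g (act (rot (-s)) x) ^ 2)
        circleProb := i1.add i2
    have i123 : Integrable (fun x => 6 * (g (act (rot s) x) ^ 2 + g (act (rot (-s)) x) ^ 2
        + g x ^ 2)) circleProb := (i12.add i3).const_mul 6
    calc ∫ x, D x ^ 2 ∂circleProb
        ≤ ∫ x, 6 * (g (act (rot s) x) ^ 2 + g (act (rot (-s)) x) ^ 2 + g x ^ 2) ∂circleProb := by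
          apply integral_mono (integrable_cont _ (by fun_prop)) i123
          intro x
          simp only [hD]
          generalize g (act (rot s) x) = a
          generalize g (act (rot (-s)) x) = b
          generalize g x = d
          have h1 : (cos s * d) ^ 2 ≤ d ^ 2 := by
            rw [mul_pow]
            nlinarith [cos_sq_le_one s, sq_nonneg d]
          rw [show 2 * cos s * d = 2 * (cos s * d) by ring]
          generalize cos s * d = e at *
          nlinarith [sq_nonneg (a - b), sq_nonneg (2 * a + e), sq_nonneg (2 * b + e)]
      _ = _ := by
          rw [integral_const_mul, integral_add i12 i3, integral_add i1 i2, e1, e2]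
          ring
  set K : ℝ := (2 * (2 / π) * (1 - cos s)) ^ 2 with hK
  set B : Fin n → Set Sp := fun i => {x : Sp | |⟪v i, (x : Pl)⟫| ≤ sin s} with hB
  have hBm : ∀ i, MeasurableSet (B i) := fun i =>
    (isClosed_le (by fun_prop) continuous_const).measurableSet
  have hgood : (⋃ i, B i)ᶜ ⊆ {x | K ≤ D x ^ 2} := by
    intro x hx
    simp only [Set.mem_compl_iff, Set.mem_iUnion, not_exists, hB, Set.mem_ofPred_eq, not_le] at hx
    have hi : ∀ i, |⟪v i, (act (rot s) x : Pl)⟫| + |⟪v i, (act (rot (-s)) x : Pl)⟫|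
        = 2 * cos s * |⟪v i, (x : Pl)⟫| := by
      intro i
      simp only [act, inner_rot, cos_neg, sin_neg, neg_mul, ← sub_eq_add_neg]
      refine abs_identity _ _ _ _ hc hS (cos_sq_add_sin_sq s) ?_ (hx i)
      have := ori.inner_sq_add_areaForm_sq (v i) (x : Pl)
      rw [Orientation.inner_rightAngleRotation_right, neg_sq, this, hv i]
      simp
    have hsum : (∑ i, α i * |⟪v i, (act (rot s) x : Pl)⟫|)
        + (∑ i, α i * |⟪v i, (act (rot (-s)) x : Pl)⟫|)
        = 2 * cos s * ∑ i, α i * |⟪v i, (x : Pl)⟫| := by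
      rw [← Finset.sum_add_distrib, Finset.mul_sum]
      refine Finset.sum_congr rfl fun i _ => ?_
      rw [← mul_add, hi i]; ring
    have : D x = - (2 * (2 / π) * (1 - cos s)) := by
      simp only [hD, hg]
      linear_combination hsum
    simp only [Set.mem_ofPred_eq, this, hK]
    rw [neg_sq]
  have hmeas : 1 / 2 ≤ circleProb.real ((⋃ i, B i)ᶜ) := by
    rw [measureReal_compl (MeasurableSet.iUnion hBm), probReal_univ]
    have : circleProb.real (⋃ i, B i) ≤ 1 / 2 := by
      calc _ ≤ ∑ i, circleProb.real (B i) := measureReal_iUnion_fintype_le _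
        _ ≤ ∑ i : Fin n, 4 * s / π := Finset.sum_le_sum fun i _ =>
            (bad_measure (v i) (hv i) _ hS).trans (by gcongr)
        _ = 1 / 2 := by
          rw [Finset.sum_const, Finset.card_univ, Fintype.card_fin, nsmul_eq_mul, hs]
          field_simp
          norm_num
    linarith
  have hmk := mul_meas_ge_le_integral_of_nonneg (μ := circleProb) (f := fun x => D x ^ 2)
    (Filter.Eventually.of_forall fun x => sq_nonneg _) (integrable_cont _ (by fun_prop)) K
  have hmono : circleProb.real ((⋃ i, B i)ᶜ) ≤ circleProb.real {x | K ≤ D x ^ 2} :=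
    measureReal_mono hgood
  have hK0 : 1 / (64 * π ^ 2 * (n:ℝ) ^ 4) ≤ K := by
    have : 1 / (64 * π ^ 2 * (n:ℝ) ^ 4) = (2 * (2 / π) * (1 / (32 * (n:ℝ) ^ 2))) ^ 2 := by
      field_simp; norm_num
    rw [this, hK]
    gcongr
  have hfin : K * (1 / 2) ≤ 18 * ∫ x, g x ^ 2 ∂circleProb :=
    calc _ ≤ K * circleProb.real {x | K ≤ D x ^ 2} := by
            gcongr
            linarith
      _ ≤ _ := hmk.trans hup
  have : 1 / (2304 * π ^ 2 * (n:ℝ) ^ 4) = 1 / (64 * π ^ 2 * (n:ℝ) ^ 4) / 36 := by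
    field_simp; norm_num
  rw [this]
  linarith

end BLMAux

/-- Bourgain–Lindenstrauss–Milman `L²` lower bound for zonogon approximation of the
disk: there is a constant `c > 0` such that for all `n ≥ 1` unit vectors `nᵢ ∈ S¹` and
weights `αᵢ ≥ 0` summing to 1, the function `f(x) = Σᵢ αᵢ|⟨nᵢ, x⟩|` on `S¹` satisfies
`‖f − 2/π‖_{L²(σ)} ≥ c·n^(−2)` for the normalized arc-length measure σ. -/
theorem BLM_L2_lower_bound_dim2 :
    ∃ c : ℝ, 0 < c ∧ ∀ n : ℕ, 1 ≤ n →
      ∀ v : Fin n → EuclideanSpace ℝ (Fin 2), (∀ i, ‖v i‖ = 1) →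
      ∀ α : Fin n → ℝ, (∀ i, 0 ≤ α i) → ∑ i, α i = 1 →
      c * (n : ℝ) ^ (-(2 : ℝ)) ≤
        Real.sqrt (∫ x : Metric.sphere (0 : EuclideanSpace ℝ (Fin 2)) 1,
          ((∑ i, α i * |⟪v i, (x : EuclideanSpace ℝ (Fin 2))⟫|) - 2 / π) ^ 2
            ∂circleProb) := by
  refine ⟨1 / (48 * π), by positivity, fun n hn v hv α _ _ => ?_⟩
  have hn0 : (1:ℝ) ≤ n := by exact_mod_cast hn
  have hpi := pi_pos
  apply Real.le_sqrt_of_sq_le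
  refine le_trans (le_of_eq ?_) (BLMAux.main_bound n hn v hv α)
  rw [Real.rpow_neg (by positivity), Real.rpow_two]
  field_simp
  norm_num
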